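/- arXiv:1412.3431 — 3 statements merged into one kernel-verified Lean document; each statement's English description precedes it below -/
import Mathlib

section
/- Let G be a finite group acting by homeomorphisms on a locally compact Hausdorff space X̃, and suppose there exists a countable family (a_ι)_{ι∈I} of continuous complex-valued functions on X̃ vanishing at infinity such that for every x ∈ X̃ and every g ∈ G the series ∑_ι a_ι(x)·conj(a_ι(g⁻¹x)) converges, with sum equal to 1 when g is the identity and equal to 0 when g is not the identity. Then the action of G on X̃ is free: gx = x for some x ∈ X̃ implies g is the identity. -/
open Filter

/-- If a finite group `G` acts by homeomorphisms on a locally compact Hausdorff space `X̃` and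
there is a countable family `(a_ι)` in `C₀(X̃)` with `∑_ι a_ι(x) conj(a_ι(g⁻¹x))` equal to `1`
for `g = 1` and to `0` otherwise, then the action of `G` is free. -/
theorem statement7 {G Xt : Type} [Group G] [Finite G] [DecidableEq G]
    [TopologicalSpace Xt] [LocallyCompactSpace Xt] [T2Space Xt] [MulAction G Xt]
    (hcont : ∀ g : G, Continuous fun x : Xt => g • x)
    (I : Type) [Countable I] (a : I → Xt → ℂ)
    (hc : ∀ i, Continuous (a i))
    (h0 : ∀ i, Tendsto (a i) (cocompact Xt) (nhds 0))
    (hsum : ∀ (x : Xt) (g : G),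
      HasSum (fun i => a i x * (starRingEnd ℂ) (a i (g⁻¹ • x)))
        (if g = 1 then 1 else 0)) :
    ∀ (g : G) (x : Xt), g • x = x → g = 1 := by
  intro g x hgx
  by_contra hg
  have hinv : g⁻¹ • x = x := inv_smul_eq_iff.mpr hgx.symm
  have hg_sum := hsum x g
  have hone_sum := hsum x 1
  rw [hinv, if_neg hg] at hg_sum
  rw [inv_one, one_smul, if_pos rfl] at hone_sum
  exact one_ne_zero (hone_sum.unique hg_sum)
end

section
/- Let G be a finite group acting by homeomorphisms on a locally compact Hausdorff space X̃, and suppose there exists a countable family (a_ι)_{ι∈I} of continuous complex-valued functions on X̃ vanishing at infinity such that for every x ∈ X̃ and every g ∈ G the series ∑_ι a_ι(x)·conj(a_ι(g⁻¹x)) converges, with sum 1 when g is the identity and 0 otherwise. Then the quotient map X̃ → X̃/G (with the quotient topology) is a covering map, each of whose fibers has exactly |G| elements. -/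
open Filter

/-- Under the hypotheses of the existence of a countable family `(a_ι)` in `C₀(X̃)` with
`∑_ι a_ι(x) conj(a_ι(g⁻¹x)) = δ_{g,1}`, the quotient map `X̃ → X̃/G` is a covering map each of
whose fibers has exactly `|G|` elements. -/
theorem statement9 {G Xt : Type} [Group G] [Finite G] [DecidableEq G]
    [TopologicalSpace Xt] [LocallyCompactSpace Xt] [T2Space Xt] [MulAction G Xt]
    (hcont : ∀ g : G, Continuous fun x : Xt => g • x)
    (I : Type) [Countable I] (a : I → Xt → ℂ)
    (hc : ∀ i, Continuous (a i))
    (h0 : ∀ i, Tendsto (a i) (cocompact Xt) (nhds 0))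
    (hsum : ∀ (x : Xt) (g : G),
      HasSum (fun i => a i x * (starRingEnd ℂ) (a i (g⁻¹ • x)))
        (if g = 1 then 1 else 0)) :
    IsCoveringMap (Quotient.mk (MulAction.orbitRel G Xt)) ∧
    ∀ y : Quotient (MulAction.orbitRel G Xt),
      Nat.card {x : Xt // Quotient.mk (MulAction.orbitRel G Xt) x = y} = Nat.card G := by
  have : ContinuousConstSMul G Xt := ⟨hcont⟩
  have : IsCancelSMul G Xt := isCancelSMul_iff_eq_one_of_smul_eq.mpr fun g x hgx => by
    by_contra hg
    have h_inv : g⁻¹ • x = x := inv_smul_eq_iff.mpr hgx.symm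
    have h_one := hsum x 1
    have h_zero := hsum x g
    rw [inv_one, one_smul, if_pos rfl] at h_one
    rw [h_inv, if_neg hg] at h_zero
    exact one_ne_zero (h_one.unique h_zero)
  have hq := isQuotientCoveringMap_quotientMk_of_properlyDiscontinuousSMul (G := G) (E := Xt)
  refine ⟨hq.isCoveringMap, fun y => ?_⟩
  obtain ⟨x, hx⟩ := hq.surjective y
  exact Nat.card_congr (hq.fiberEquivGroup ⟨x, hx⟩)
end

section
/- Let X̃, X be locally compact Hausdorff spaces, let G be a finite group acting by homeomorphisms on X̃, and let p : X̃ → X be a continuous surjection with p ∘ g = p for all g ∈ G such that the pullback map h ↦ h ∘ p is an injection of C₀(X) into C₀(X̃) whose image is exactly the set of G-invariant functions in C₀(X̃). Then the induced continuous map X̃/G → X is a homeomorphism. -/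
open Filter

/-- For a finite group acting by homeomorphisms on a locally compact Hausdorff space, every
neighbourhood of a point carries, up to translation, the nonvanishing locus of an invariant
`C₀` function not vanishing at that point. -/
theorem exists_invariant_vanishing_at_infinity {G Y : Type*} [Group G] [Finite G]
    [TopologicalSpace Y] [LocallyCompactSpace Y] [T2Space Y] [MulAction G Y]
    [ContinuousConstSMul G Y] {U : Set Y} (hU : IsOpen U) {x : Y} (hx : x ∈ U) :
    ∃ f : Y → ℂ, Continuous f ∧ Tendsto f (cocompact Y) (nhds 0) ∧
      (∀ (g : G) (y : Y), f (g • y) = f y) ∧ f x ≠ 0 ∧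
      ∀ y, f y ≠ 0 → ∃ g : G, g • y ∈ U := by
  classical
  have := Fintype.ofFinite G
  obtain ⟨φ, hφ1, hφ0, hφc, hφI⟩ := exists_continuous_one_zero_of_isCompact
    (isCompact_singleton (x := x)) hU.isClosed_compl (by simpa using hx)
  have hφt : Tendsto φ (cocompact Y) (nhds 0) := hφc.is_zero_at_infty
  refine ⟨fun y => ((∑ g : G, φ (g • y) : ℝ) : ℂ), by fun_prop, ?_, ?_, ?_, ?_⟩
  · have h : Tendsto (fun y => ∑ g : G, φ (g • y)) (cocompact Y) (nhds (∑ _g : G, 0)) :=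
      tendsto_finsetSum _ fun g _ =>
        hφt.comp (Homeomorph.smul g).isClosedEmbedding.tendsto_cocompact
    simpa [Function.comp_def] using (Complex.continuous_ofReal.tendsto _).comp h
  · intro g y
    simp only [smul_smul]
    rw [Fintype.sum_equiv (Equiv.mulRight g) (fun k => φ ((k * g) • y)) (fun k => φ (k • y))
      fun _ => rfl]
  · have hx1 : φ ((1 : G) • x) = 1 := by simpa using hφ1 (Set.mem_singleton x)
    have h : φ ((1 : G) • x) ≤ ∑ g : G, φ (g • x) :=
      Finset.single_le_sum (f := fun g : G => φ (g • x)) (fun g _ => (hφI _).1)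
        (Finset.mem_univ 1)
    exact Complex.ofReal_ne_zero.2 (by linarith)
  · intro y hy
    obtain ⟨g, -, hg⟩ := Finset.exists_ne_zero_of_sum_ne_zero (Complex.ofReal_ne_zero.1 hy)
    exact ⟨g, by_contra fun h => hg (hφ0 h)⟩

/-- If `p : X̃ → X` is a continuous `G`-invariant surjection such that pullback along `p` is an
injection of `C₀(X)` into `C₀(X̃)` with image exactly the `G`-invariant elements of `C₀(X̃)`,
then the induced map `X̃/G → X` is a homeomorphism. -/
theorem statement10 {G Xt X : Type} [Group G] [Finite G]
    [TopologicalSpace Xt] [TopologicalSpace X]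
    [LocallyCompactSpace Xt] [T2Space Xt] [LocallyCompactSpace X] [T2Space X]
    [MulAction G Xt]
    (hcont : ∀ g : G, Continuous fun x : Xt => g • x)
    (p : Xt → X) (hp : Continuous p) (hsurj : Function.Surjective p)
    (hGinv : ∀ (g : G) (x : Xt), p (g • x) = p x)
    (hpull : ∀ h : X → ℂ, Continuous h → Tendsto h (cocompact X) (nhds 0) →
      Tendsto (h ∘ p) (cocompact Xt) (nhds 0))
    (hinj : ∀ h h' : X → ℂ, Continuous h → Tendsto h (cocompact X) (nhds 0) →
      Continuous h' → Tendsto h' (cocompact X) (nhds 0) →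
      h ∘ p = h' ∘ p → h = h')
    (himg : ∀ f : Xt → ℂ, Continuous f → Tendsto f (cocompact Xt) (nhds 0) →
      (∀ (g : G) (x : Xt), f (g • x) = f x) →
      ∃ h : X → ℂ, Continuous h ∧ Tendsto h (cocompact X) (nhds 0) ∧ f = h ∘ p) :
    ∃ e : Quotient (MulAction.orbitRel G Xt) ≃ₜ X,
      ∀ x : Xt, e (Quotient.mk (MulAction.orbitRel G Xt) x) = p x := by
  have : ContinuousConstSMul G Xt := ⟨hcont⟩
  have hopen : IsOpenMap p := by
    intro U hU
    rw [isOpen_iff_mem_nhds]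
    rintro _ ⟨x, hx, rfl⟩
    obtain ⟨f, hfc, hf0, hfG, hfx, hfU⟩ :=
      exists_invariant_vanishing_at_infinity (G := G) hU hx
    obtain ⟨h, hc, -, rfl⟩ := himg f hfc hf0 hfG
    filter_upwards [(isOpen_ne_fun hc continuous_const).mem_nhds hfx] with y hy
    obtain ⟨z, rfl⟩ := hsurj y
    obtain ⟨g, hg⟩ := hfU z hy
    exact ⟨g • z, hg, hGinv g z⟩
  have hfib : ∀ x y : Xt, p x = p y → x ∈ MulAction.orbit G y := by
    intro x y hxy
    by_contra hx
    have hU : IsOpen (MulAction.orbit G y)ᶜ :=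
      (Set.finite_range fun g : G => g • y).isClosed.isOpen_compl
    obtain ⟨f, hfc, hf0, hfG, hfx, hfU⟩ :=
      exists_invariant_vanishing_at_infinity (G := G) hU hx
    obtain ⟨h, -, -, rfl⟩ := himg f hfc hf0 hfG
    obtain ⟨g, hg⟩ := hfU y (by simpa [hxy] using hfx)
    exact hg (MulAction.mem_orbit y g)
  have hrel : ∀ x y : Xt, (MulAction.orbitRel G Xt) x y → p x = p y := by
    rintro _ y ⟨g, rfl⟩
    exact hGinv g y
  let q : Quotient (MulAction.orbitRel G Xt) → X := Quotient.lift p hrel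
  have hq : Function.Bijective q := by
    refine ⟨?_, fun y => ?_⟩
    · rintro ⟨x⟩ ⟨y⟩ hxy
      exact Quotient.sound (hfib x y hxy)
    · obtain ⟨x, rfl⟩ := hsurj y
      exact ⟨Quotient.mk _ x, rfl⟩
  have hqo : IsOpenMap q := by
    intro V hV
    rw [← Set.image_preimage_eq V Quotient.mk_surjective, Set.image_image]
    exact hopen _ (hV.preimage continuous_quotient_mk')
  exact ⟨(Equiv.ofBijective q hq).toHomeomorphOfContinuousOpen (hp.quotient_lift hrel) hqo,
    fun _ => rfl⟩
end
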